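/- arXiv:1908.09671 — 2 statements merged into one kernel-verified Lean document; each statement's English description precedes it below -/
import Mathlib

section
/- Vertex lemma, first part: let p = ⟨i, j⟩ and q = ⟨i', j'⟩ be two distinct elements of I. Then the point e_p + e_q is an extreme point of P (over ℝ) if and only if i ≠ i' and min (a i) (a i') = 1. -/
open Finset

/-- The sum over one block of a vector supported at a single index. -/
lemma sum_block_single {ι M : Type*} [DecidableEq ι] [AddCommMonoid M] (β : ι → Type*)
    [∀ i, Fintype (β i)] [∀ i, DecidableEq (β i)] (p : Σ i, β i) (u : M) (i : ι) :
    ∑ j, (Pi.single p u : (Σ i, β i) → M) ⟨i, j⟩ = if p.1 = i then u else 0 := by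
  obtain ⟨i', j'⟩ := p
  by_cases h : i' = i
  · subst h
    simp [Pi.single_apply]
  · have h' : ∀ j, (⟨i, j⟩ : Σ i, β i) ≠ ⟨i', j'⟩ := fun j hj => h (congrArg Sigma.fst hj).symm
    simp [h, h']

/-- The linear inequalities satisfied by the convex hull of the lattice points with bounded block
sums and total sum at least two. -/
lemma convexHull_natCast_subset {ι : Type*} [Fintype ι] {β : ι → Type*} [∀ i, Fintype (β i)]
    (a : ι → ℕ) :
    convexHull ℝ ((fun (c : (Σ i, β i) → ℕ) (p : Σ i, β i) => (c p : ℝ)) ''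
      {c | (∀ i, ∑ j, c ⟨i, j⟩ ≤ a i) ∧ 2 ≤ ∑ p, c p}) ⊆
      {x | (∀ p, 0 ≤ x p) ∧ (∀ i, ∑ j, x ⟨i, j⟩ ≤ a i) ∧ 2 ≤ ∑ p, x p} := by
  refine convexHull_min ?_ ?_
  · rintro _ ⟨c, ⟨hc, hc2⟩, rfl⟩
    exact ⟨fun p => Nat.cast_nonneg _, fun i => by dsimp only; exact_mod_cast hc i,
      by dsimp only; exact_mod_cast hc2⟩
  · rintro x ⟨hx, hxa, hx2⟩ y ⟨hy, hya, hy2⟩ s t hs ht hst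
    refine ⟨fun p => ?_, fun i => ?_, ?_⟩
    · exact add_nonneg (mul_nonneg hs (hx p)) (mul_nonneg ht (hy p))
    · simp only [Pi.add_apply, Pi.smul_apply, smul_eq_mul, sum_add_distrib, ← mul_sum]
      calc _ ≤ s * (a i : ℝ) + t * a i := by gcongr <;> simp [hxa, hya]
        _ = a i := by rw [← add_mul, hst, one_mul]
    · simp only [Pi.add_apply, Pi.smul_apply, smul_eq_mul, sum_add_distrib, ← mul_sum]
      calc (2 : ℝ) = s * 2 + t * 2 := by rw [← add_mul, hst, one_mul]
        _ ≤ _ := by gcongr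

/-- A set of nonnegative vectors with total sum at least two and `p`-th coordinate at most one has
`e_p + e_q` as an extreme point as soon as it contains it. -/
lemma single_add_single_mem_extremePoints {ι : Type*} [Fintype ι] [DecidableEq ι]
    {P : Set (ι → ℝ)} {p q : ι} (hpq : p ≠ q)
    (hmem : Pi.single p (1 : ℝ) + Pi.single q (1 : ℝ) ∈ P)
    (hnonneg : ∀ x ∈ P, ∀ r, 0 ≤ x r) (hsum : ∀ x ∈ P, 2 ≤ ∑ r, x r)
    (hp : ∀ x ∈ P, x p ≤ 1) :
    Pi.single p (1 : ℝ) + Pi.single q (1 : ℝ) ∈ Set.extremePoints ℝ P := by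
  rw [mem_extremePoints_iff_left]
  refine ⟨hmem, fun x hx y hy ⟨s, t, hs, ht, hst, hxy⟩ => ?_⟩
  have hcoord : ∀ r, s * x r + t * y r =
      (Pi.single p (1 : ℝ) + Pi.single q (1 : ℝ) : ι → ℝ) r := fun r => congrFun hxy r
  have hoff : ∀ r, r ≠ p → r ≠ q → x r = 0 ∧ y r = 0 := by
    intro r hrp hrq
    have h := hcoord r
    simp only [Pi.add_apply, Pi.single_eq_of_ne hrp, Pi.single_eq_of_ne hrq, add_zero] at h
    have h1 := mul_nonneg hs.le (hnonneg x hx r)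
    have h2 := mul_nonneg ht.le (hnonneg y hy r)
    exact ⟨(mul_eq_zero.1 (by linarith : s * x r = 0)).resolve_left hs.ne',
      (mul_eq_zero.1 (by linarith : t * y r = 0)).resolve_left ht.ne'⟩
  have hsx : 2 ≤ x p + x q := by
    rw [← Fintype.sum_eq_add p q hpq fun r hr => (hoff r hr.1 hr.2).1]
    exact hsum x hx
  have hsy : 2 ≤ y p + y q := by
    rw [← Fintype.sum_eq_add p q hpq fun r hr => (hoff r hr.1 hr.2).2]
    exact hsum y hy
  have hcp : s * x p + t * y p = 1 := by simpa [hpq] using hcoord p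
  have hcq : s * x q + t * y q = 1 := by simpa [hpq.symm] using hcoord q
  have hxp : x p = 1 := by nlinarith [hp x hx, hp y hy]
  have hxq : x q = 1 := by nlinarith [hp x hx, hp y hy]
  funext r
  by_cases hrp : r = p
  · subst hrp
    simp [hpq, hxp]
  by_cases hrq : r = q
  · subst hrq
    simp [hpq.symm, hxq]
  simp [hrp, hrq, (hoff r hrp hrq).1]

/-- `e_p + e_q` is the midpoint of `2 e_p` and `2 e_q`, hence not extreme in a set containing
these. -/
lemma single_add_single_notMem_extremePoints {ι : Type*} [DecidableEq ι]
    {P : Set (ι → ℝ)} {p q : ι} (hpq : p ≠ q)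
    (hp : Pi.single p (2 : ℝ) ∈ P) (hq : Pi.single q (2 : ℝ) ∈ P) :
    Pi.single p (1 : ℝ) + Pi.single q (1 : ℝ) ∉ Set.extremePoints ℝ P := by
  intro h
  have h' := (mem_extremePoints_iff_left.1 h).2 _ hp _ hq
    ⟨1 / 2, 1 / 2, by norm_num, by norm_num, by norm_num, by simp [← Pi.single_smul]⟩
  simpa [hpq] using congrFun h' p

/-- Vertex lemma, first part: for distinct `p = ⟨i,j⟩`, `q = ⟨i',j'⟩` in `I`, the point
`e_p + e_q` is a vertex of `P` iff `i ≠ i'` and `min (a i) (a i') = 1`. -/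
theorem stmt_6 (k : ℕ) (hk : 1 ≤ k) (a b : Fin k → ℕ)
    (ha : ∀ i, 1 ≤ a i) (hb : ∀ i, 1 ≤ b i)
    (S : Set ((Σ i : Fin k, Fin (b i)) → ℕ))
    (hS : S = {c | (∀ i : Fin k, ∑ j, c ⟨i, j⟩ ≤ a i) ∧ 2 ≤ ∑ p, c p})
    (P : Set ((Σ i : Fin k, Fin (b i)) → ℝ))
    (hP : P = convexHull ℝ ((fun (c : (Σ i : Fin k, Fin (b i)) → ℕ)
      (p : Σ i : Fin k, Fin (b i)) => (c p : ℝ)) '' S))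
    (p q : Σ i : Fin k, Fin (b i)) (hpq : p ≠ q) :
    (Pi.single p (1 : ℝ) + Pi.single q (1 : ℝ)) ∈ Set.extremePoints ℝ P ↔
      p.1 ≠ q.1 ∧ min (a p.1) (a q.1) = 1 := by
  subst hS hP
  have hsub := convexHull_natCast_subset (β := fun i => Fin (b i)) a
  constructor
  · intro h
    have hbound := (hsub h.1).2.1
    simp only [Pi.add_apply, sum_add_distrib,
      sum_block_single fun i => Fin (b i)] at hbound
    by_contra hcon
    have htwo : 2 ≤ a p.1 ∧ 2 ≤ a q.1 := by
      by_cases hne : p.1 = q.1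
      · have h1 := hbound q.1
        simp only [hne, if_true] at h1
        have h2 : 2 ≤ a q.1 := by
          have : (2 : ℝ) ≤ a q.1 := by linarith
          exact_mod_cast this
        exact ⟨hne ▸ h2, h2⟩
      · have h1 := ha p.1
        have h2 := ha q.1
        have h3 : min (a p.1) (a q.1) ≠ 1 := fun h3 => hcon ⟨hne, h3⟩
        omega
    have hmem : ∀ r : Σ i : Fin k, Fin (b i), 2 ≤ a r.1 →
        (Pi.single r (2 : ℝ)) ∈ convexHull ℝ ((fun (c : (Σ i : Fin k, Fin (b i)) → ℕ)
          (p : Σ i : Fin k, Fin (b i)) => (c p : ℝ)) ''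
          {c | (∀ i : Fin k, ∑ j, c ⟨i, j⟩ ≤ a i) ∧ 2 ≤ ∑ p, c p}) := by
      intro r hr
      refine subset_convexHull ℝ _ ⟨Pi.single r 2, ⟨fun i => ?_, by simp⟩, ?_⟩
      · rw [sum_block_single fun i => Fin (b i)]
        split_ifs with hi
        · exact hi ▸ hr
        · exact Nat.zero_le _
      · funext s
        simp [Pi.single_apply]
    exact single_add_single_notMem_extremePoints hpq (hmem p htwo.1) (hmem q htwo.2) h
  · rintro ⟨hne, hmin⟩
    have hmem : (Pi.single p (1 : ℝ) + Pi.single q (1 : ℝ)) ∈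
        convexHull ℝ ((fun (c : (Σ i : Fin k, Fin (b i)) → ℕ)
          (p : Σ i : Fin k, Fin (b i)) => (c p : ℝ)) ''
          {c | (∀ i : Fin k, ∑ j, c ⟨i, j⟩ ≤ a i) ∧ 2 ≤ ∑ p, c p}) := by
      refine subset_convexHull ℝ _
        ⟨Pi.single p 1 + Pi.single q 1, ⟨fun i => ?_, by simp [sum_add_distrib]⟩, ?_⟩
      · simp only [Pi.add_apply, sum_add_distrib,
      sum_block_single fun i => Fin (b i)]
        have := ha i
        split_ifs with h1 h2
        · exact absurd (h1.trans h2.symm) hne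
        all_goals omega
      · funext s
        simp [Pi.single_apply]
    have hone : ∀ r : Σ i : Fin k, Fin (b i), a r.1 = 1 → ∀ x ∈ convexHull ℝ
        ((fun (c : (Σ i : Fin k, Fin (b i)) → ℕ) (p : Σ i : Fin k, Fin (b i)) => (c p : ℝ)) ''
          {c | (∀ i : Fin k, ∑ j, c ⟨i, j⟩ ≤ a i) ∧ 2 ≤ ∑ p, c p}), x r ≤ 1 := by
      intro r hr x hx
      obtain ⟨hx0, hxa, -⟩ := hsub hx
      calc x r ≤ ∑ j, x ⟨r.1, j⟩ :=
            single_le_sum (f := fun j => x ⟨r.1, j⟩) (fun j _ => hx0 _) (mem_univ r.2)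
        _ ≤ a r.1 := hxa r.1
        _ = 1 := by simp [hr]
    have hnonneg := fun x hx => (hsub (a := x) hx).1
    have hsum := fun x hx => (hsub (a := x) hx).2.2
    rcases (min_choice (a p.1) (a q.1)) with h | h
    · exact single_add_single_mem_extremePoints hpq hmem hnonneg hsum (hone p (h ▸ hmin))
    · rw [add_comm] at hmem ⊢
      exact single_add_single_mem_extremePoints hpq.symm hmem hnonneg hsum (hone q (h ▸ hmin))
end

section
/- Complete classification of the vertices of the secant polytope (combining the paper's vertex lemma with the observation that vertices off the facet F are vertices of the product of dilated simplices): a point v : I → ℝ is an extreme point of P over ℝ if and only if at least one of the following holds: (i) there exist a subset T ⊆ Fin k and a choice j : (i : Fin k) → Fin (b i) such that v = ∑_{i ∈ T} (a i) • e_{⟨i, j i⟩} and 2 ≤ ∑_{i ∈ T} a i; (ii) there exist p = ⟨i, j⟩ and q = ⟨i', j'⟩ in I with i ≠ i' and min (a i) (a i') = 1 such that v = e_p + e_q; (iii) there exists p = ⟨i, j⟩ ∈ I with 2 ≤ a i such that v = 2 • e_p. -/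
open Finset

section SecantPolytope

variable {k : ℕ} {a b : Fin k → ℕ}

theorem sum_block_single_s15 (p : Σ i : Fin k, Fin (b i)) (m : ℕ) (i : Fin k) :
    ∑ j, (Pi.single p m : (Σ i : Fin k, Fin (b i)) → ℕ) ⟨i, j⟩ = if i = p.1 then m else 0 := by
  obtain ⟨i', j'⟩ := p
  by_cases h : i = i'
  · subst h
    rw [Finset.sum_eq_single j']
    · simp
    · intro j _ hj
      exact Pi.single_eq_of_ne (by simpa using hj) _
    · simp
  · rw [if_neg h]
    refine Finset.sum_eq_zero fun j _ => Pi.single_eq_of_ne ?_ _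
    intro e
    exact h (congrArg Sigma.fst e)

theorem exists_eq_add_single {ι : Type*} [DecidableEq ι] (c : ι → ℕ) (p : ι) (hp : c p ≠ 0) :
    ∃ r : ι → ℕ, c = r + Pi.single p 1 := by
  refine ⟨c - Pi.single p 1, ?_⟩
  ext q
  by_cases h : q = p
  · subst h
    simp
    omega
  · simp [h]

theorem exists_single_add_single_of_sum_eq_two {ι : Type*} [DecidableEq ι] [Fintype ι]
    (c : ι → ℕ) (hc : ∑ p, c p = 2) :
    ∃ p q : ι, c = Pi.single p 1 + Pi.single q 1 := by
  obtain ⟨p, -, hp⟩ := Finset.exists_ne_zero_of_sum_ne_zero (s := univ) (f := c) (by omega)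
  obtain ⟨r, rfl⟩ := exists_eq_add_single c p hp
  simp only [Pi.add_apply, Finset.sum_add_distrib, Finset.sum_pi_single', Finset.mem_univ,
    if_true, Nat.reduceEqDiff] at hc
  obtain ⟨q, -, hq⟩ := Finset.exists_ne_zero_of_sum_ne_zero (s := univ) (f := r) (by omega)
  obtain ⟨t, rfl⟩ := exists_eq_add_single r q hq
  simp only [Pi.add_apply, Finset.sum_add_distrib, Finset.sum_pi_single', Finset.mem_univ,
    if_true, Nat.reduceEqDiff] at hc
  have ht : t = 0 := by
    ext x
    exact Finset.sum_eq_zero_iff.1 (by omega : ∑ x, t x = 0) x (Finset.mem_univ _)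
  exact ⟨q, p, by rw [ht, zero_add]⟩

/-- The lattice points whose convex hull is the secant polytope. -/
def secantLattice (a b : Fin k → ℕ) : Set ((Σ i : Fin k, Fin (b i)) → ℕ) :=
  {c | (∀ i : Fin k, ∑ j, c ⟨i, j⟩ ≤ a i) ∧ 2 ≤ ∑ p, c p}

/-- The secant polytope. -/
def secantPolytope (a b : Fin k → ℕ) : Set ((Σ i : Fin k, Fin (b i)) → ℝ) :=
  convexHull ℝ ((fun (c : (Σ i : Fin k, Fin (b i)) → ℕ)
    (p : Σ i : Fin k, Fin (b i)) => (c p : ℝ)) '' secantLattice a b)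

theorem bounds_of_mem_secantPolytope {x : (Σ i : Fin k, Fin (b i)) → ℝ}
    (hx : x ∈ secantPolytope a b) :
    (∀ p, 0 ≤ x p) ∧ (∀ i, ∑ j, x ⟨i, j⟩ ≤ a i) ∧ 2 ≤ ∑ p, x p := by
  suffices h : secantPolytope a b ⊆
      {x | (∀ p, 0 ≤ x p) ∧ (∀ i, ∑ j, x ⟨i, j⟩ ≤ a i) ∧ 2 ≤ ∑ p, x p} from h hx
  refine convexHull_min ?_ ?_
  · rintro _ ⟨c, hc, rfl⟩
    refine ⟨fun p => Nat.cast_nonneg _, fun i => ?_, ?_⟩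
    · dsimp only
      exact_mod_cast hc.1 i
    · dsimp only
      exact_mod_cast hc.2
  · rintro x ⟨hx0, hx1, hx2⟩ y ⟨hy0, hy1, hy2⟩ s t hs ht hst
    refine ⟨fun p => ?_, fun i => ?_, ?_⟩
    · exact add_nonneg (mul_nonneg hs (hx0 p)) (mul_nonneg ht (hy0 p))
    · simp only [Pi.add_apply, Pi.smul_apply, smul_eq_mul, Finset.sum_add_distrib,
        ← Finset.mul_sum]
      calc _ ≤ s * (a i : ℝ) + t * a i := by gcongr; exacts [hx1 i, hy1 i]
        _ = a i := by rw [← add_mul, hst, one_mul]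
    · simp only [Pi.add_apply, Pi.smul_apply, smul_eq_mul, Finset.sum_add_distrib,
        ← Finset.mul_sum]
      calc (2 : ℝ) = s * 2 + t * 2 := by rw [← add_mul, hst, one_mul]
        _ ≤ _ := by gcongr

/-- A lattice point is a vertex as soon as the constraints that are tight at it determine it. -/
theorem mem_extremePoints_of_tight {c : (Σ i : Fin k, Fin (b i)) → ℕ} (hc : c ∈ secantLattice a b)
    (h : ∀ x : (Σ i : Fin k, Fin (b i)) → ℝ, (∀ p, c p = 0 → x p = 0) →
      (∀ i, ∑ j, c ⟨i, j⟩ = a i → ∑ j, x ⟨i, j⟩ = a i) →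
      (∑ p, c p = 2 → ∑ p, x p = 2) → ∀ p, x p = c p) :
    (fun p => (c p : ℝ)) ∈ Set.extremePoints ℝ (secantPolytope a b) := by
  have key : ∀ {s t X Y m : ℝ}, 0 < s → 0 < t → s + t = 1 → s * X + t * Y = m → X ≤ m →
      Y ≤ m → X = m := by
    intro s t X Y m hs ht hst e hX hY
    refine le_antisymm hX ?_
    by_contra! hlt
    have h1 := mul_lt_mul_of_pos_left hlt hs
    have h2 := mul_le_mul_of_nonneg_left hY ht.le
    have h3 : s * m + t * m = m := by rw [← add_mul, hst, one_mul]
    linarith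
  rw [mem_extremePoints_iff_left]
  refine ⟨subset_convexHull _ _ ⟨c, hc, rfl⟩, ?_⟩
  rintro x hx y hy ⟨s, t, hs, ht, hst, hv⟩
  obtain ⟨hx0, hx1, hx2⟩ := bounds_of_mem_secantPolytope hx
  obtain ⟨hy0, hy1, hy2⟩ := bounds_of_mem_secantPolytope hy
  have hv' : ∀ p, s * x p + t * y p = c p := fun p => congrFun hv p
  funext p
  refine h x (fun p hp => ?_) (fun i hi => ?_) (fun h2 => ?_) p
  · have e := hv' p
    rw [hp, Nat.cast_zero] at e
    have := key (X := -x p) (Y := -y p) (m := 0) hs ht hst (by linarith)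
      (by linarith [hx0 p]) (by linarith [hy0 p])
    linarith
  · refine key hs ht hst ?_ (hx1 i) (hy1 i)
    rw [Finset.mul_sum, Finset.mul_sum, ← Finset.sum_add_distrib, ← hi, Nat.cast_sum]
    exact Finset.sum_congr rfl fun j _ => hv' _
  · have e : s * ∑ p, x p + t * ∑ p, y p = 2 := by
      rw [Finset.mul_sum, Finset.mul_sum, ← Finset.sum_add_distrib,
        Finset.sum_congr rfl fun p _ => hv' p]
      exact_mod_cast h2
    have := key (X := -∑ p, x p) (Y := -∑ p, y p) (m := -2) hs ht hst (by linarith)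
      (by linarith) (by linarith)
    linarith

theorem eq_of_add_eq_two_mul {c d e : (Σ i : Fin k, Fin (b i)) → ℕ}
    (hc : (fun p => (c p : ℝ)) ∈ Set.extremePoints ℝ (secantPolytope a b))
    (hd : d ∈ secantLattice a b) (he : e ∈ secantLattice a b)
    (h : ∀ p, d p + e p = 2 * c p) : d = c := by
  rw [mem_extremePoints_iff_left] at hc
  have := hc.2 _ (subset_convexHull _ _ ⟨d, hd, rfl⟩) _ (subset_convexHull _ _ ⟨e, he, rfl⟩)
    ⟨1 / 2, 1 / 2, by norm_num, by norm_num, by norm_num, ?_⟩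
  · funext p
    exact Nat.cast_injective (R := ℝ) (congrFun this p)
  · funext p
    have hp : (d p : ℝ) + e p = 2 * c p := by exact_mod_cast h p
    simp only [Pi.add_apply, Pi.smul_apply, smul_eq_mul]
    linarith

theorem add_single_mem_secantLattice_iff {r : (Σ i : Fin k, Fin (b i)) → ℕ}
    {p : Σ i : Fin k, Fin (b i)} {m : ℕ} :
    r + Pi.single p m ∈ secantLattice a b ↔
      (∀ i, ∑ j, r ⟨i, j⟩ + (if i = p.1 then m else 0) ≤ a i) ∧ 2 ≤ ∑ p, r p + m := by
  simp only [secantLattice, Set.mem_ofPred_eq, Pi.add_apply, Finset.sum_add_distrib,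
    sum_block_single_s15, Finset.sum_pi_single', Finset.mem_univ, if_true]

/-- Moving a unit between `p` and `q` must leave the polytope at a vertex. -/
theorem eq_of_extreme_add_single_add_single {r : (Σ i : Fin k, Fin (b i)) → ℕ}
    {p q : Σ i : Fin k, Fin (b i)}
    (hc : (fun x => ((r + Pi.single p 1 + Pi.single q 1 : (Σ i : Fin k, Fin (b i)) → ℕ) x : ℝ)) ∈
      Set.extremePoints ℝ (secantPolytope a b))
    (hp : r + Pi.single p 2 ∈ secantLattice a b) (hq : r + Pi.single q 2 ∈ secantLattice a b) :
    p = q := by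
  have h := eq_of_add_eq_two_mul hc hp hq fun x => by
    simp only [Pi.add_apply, Pi.single_apply]
    split_ifs <;> omega
  by_contra hne
  have := congrFun h p
  simp [hne] at this

/-- A vertex has at most one nonzero coordinate in each block. -/
theorem eq_of_extreme_of_fst_eq {c : (Σ i : Fin k, Fin (b i)) → ℕ} (hS : c ∈ secantLattice a b)
    (hc : (fun p => (c p : ℝ)) ∈ Set.extremePoints ℝ (secantPolytope a b))
    {p q : Σ i : Fin k, Fin (b i)} (hpq : p.1 = q.1) (hp : c p ≠ 0) (hq : c q ≠ 0) : p = q := by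
  by_contra hne
  obtain ⟨s, rfl⟩ := exists_eq_add_single c q hq
  obtain ⟨r, rfl⟩ := exists_eq_add_single s p (by simpa [hne] using hp)
  refine hne (eq_of_extreme_add_single_add_single hc ?_ ?_) <;>
  · rw [add_single_mem_secantLattice_iff] at hS ⊢
    simp only [Pi.add_apply, Finset.sum_add_distrib, sum_block_single_s15, Finset.sum_pi_single',
      Finset.mem_univ, if_true, hpq] at hS ⊢
    refine ⟨fun i => ?_, by omega⟩
    have := hS.1 i
    split_ifs at this ⊢ <;> omega

/-- Off the facet of coordinate sum two, the block sums of a vertex are zero or maximal. -/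
theorem eq_of_extreme_of_three_le {c : (Σ i : Fin k, Fin (b i)) → ℕ} (hS : c ∈ secantLattice a b)
    (hc : (fun p => (c p : ℝ)) ∈ Set.extremePoints ℝ (secantPolytope a b))
    (h3 : 3 ≤ ∑ p, c p) {p : Σ i : Fin k, Fin (b i)} (hp : c p ≠ 0) :
    ∑ j, c ⟨p.1, j⟩ = a p.1 := by
  by_contra hne
  obtain ⟨r, rfl⟩ := exists_eq_add_single c p hp
  simp only [Pi.add_apply, Finset.sum_add_distrib, sum_block_single_s15, Finset.sum_pi_single',
      Finset.mem_univ, if_true] at hne h3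
  rw [add_single_mem_secantLattice_iff] at hS
  have h1 : r ∈ secantLattice a b :=
    ⟨fun i => (Nat.le_add_right _ _).trans (hS.1 i), by omega⟩
  have h2 : r + Pi.single p 2 ∈ secantLattice a b := by
    rw [add_single_mem_secantLattice_iff]
    refine ⟨fun i => ?_, by omega⟩
    have := hS.1 i
    by_cases h : i = p.1
    · subst h
      rw [if_pos rfl] at this ⊢
      omega
    · rwa [if_neg h] at this ⊢
  have h := congrFun (eq_of_add_eq_two_mul hc h1 h2 fun x => by
    simp only [Pi.add_apply, Pi.single_apply]
    split_ifs <;> omega) p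
  simp at h

/-- A choice of one entry, equal to `a i`, in each block `i ∈ T`. -/
def productVertex (a b : Fin k → ℕ) (T : Finset (Fin k)) (j : (i : Fin k) → Fin (b i)) :
    (Σ i : Fin k, Fin (b i)) → ℕ :=
  fun p => if p.1 ∈ T ∧ j p.1 = p.2 then a p.1 else 0

theorem cast_productVertex (T : Finset (Fin k)) (j : (i : Fin k) → Fin (b i)) :
    (fun p => (productVertex a b T j p : ℝ)) = ∑ i ∈ T, (a i : ℝ) •
      (Pi.single (⟨i, j i⟩ : Σ i : Fin k, Fin (b i)) (1 : ℝ) :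
        (Σ i : Fin k, Fin (b i)) → ℝ) := by
  funext ⟨i, l⟩
  rw [Finset.sum_apply]
  have h0 : ∀ i' ∈ T, i' ≠ i → ((a i' : ℝ) •
      (Pi.single (⟨i', j i'⟩ : Σ i : Fin k, Fin (b i)) (1 : ℝ) :
        (Σ i : Fin k, Fin (b i)) → ℝ)) ⟨i, l⟩ = 0 := by
    intro i' _ hne
    rw [Pi.smul_apply, Pi.single_eq_of_ne, smul_zero]
    intro e
    exact hne (congrArg Sigma.fst e).symm
  by_cases hi : i ∈ T
  · rw [Finset.sum_eq_single i h0 (absurd hi)]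
    by_cases hl : j i = l
    · subst hl
      simp [productVertex, hi]
    · simp [productVertex, hl, Ne.symm hl]
  · rw [Finset.sum_eq_zero fun i' hi' => h0 i' hi' fun e => hi (e ▸ hi')]
    simp [productVertex, hi]

theorem sum_block_productVertex (T : Finset (Fin k)) (j : (i : Fin k) → Fin (b i)) (i : Fin k) :
    ∑ l, productVertex a b T j ⟨i, l⟩ = if i ∈ T then a i else 0 := by
  by_cases hi : i ∈ T <;> simp [productVertex, hi]

theorem sum_productVertex (T : Finset (Fin k)) (j : (i : Fin k) → Fin (b i)) :
    ∑ p, productVertex a b T j p = ∑ i ∈ T, a i := by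
  rw [Fintype.sum_sigma]
  simp [sum_block_productVertex]

theorem productVertex_mem_extremePoints (T : Finset (Fin k)) (j : (i : Fin k) → Fin (b i))
    (hT : 2 ≤ ∑ i ∈ T, a i) :
    (fun p => (productVertex a b T j p : ℝ)) ∈ Set.extremePoints ℝ (secantPolytope a b) := by
  refine mem_extremePoints_of_tight ⟨fun i => ?_, by rwa [sum_productVertex]⟩ ?_
  · rw [sum_block_productVertex]
    split_ifs <;> simp
  · rintro x h0 h1 - ⟨i, l⟩
    by_cases h : i ∈ T ∧ j i = l
    · obtain ⟨hi, rfl⟩ := h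
      have := h1 i (by rw [sum_block_productVertex, if_pos hi])
      rw [Finset.sum_eq_single (j i) (fun l _ hl => h0 _ (by simp [productVertex, Ne.symm hl]))
        (by simp)] at this
      simpa [productVertex, hi] using this
    · have : productVertex a b T j ⟨i, l⟩ = 0 := if_neg h
      rw [h0 _ this, this, Nat.cast_zero]

theorem single_add_single_mem_extremePoints_s15 (ha : ∀ i, 1 ≤ a i) {p q : Σ i : Fin k, Fin (b i)}
    (hpq : p.1 ≠ q.1) (hp : a p.1 = 1) :
    (fun x => ((Pi.single p 1 + Pi.single q 1 : (Σ i : Fin k, Fin (b i)) → ℕ) x : ℝ)) ∈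
      Set.extremePoints ℝ (secantPolytope a b) := by
  have hne : p ≠ q := fun e => hpq (congrArg _ e)
  refine mem_extremePoints_of_tight ?_ ?_
  · rw [add_single_mem_secantLattice_iff]
    refine ⟨fun i => ?_, by simp⟩
    rw [sum_block_single_s15]
    have := ha i
    split_ifs with h1 h2
    · exact absurd (h1.symm.trans h2) hpq
    all_goals omega
  · intro x h0 h1 h2
    have h0' : ∀ y, y ≠ p → y ≠ q → x y = 0 := fun y hyp hyq => h0 y (by simp [hyp, hyq])
    have hxp : x p = 1 := by
      have := h1 p.1 (by
        simp only [Pi.add_apply, Finset.sum_add_distrib, sum_block_single_s15, if_neg hpq, hp]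
        simp)
      rw [Finset.sum_eq_single p.2 (fun l _ hl => h0' _ ?_ ?_) (by simp), hp] at this
      · simpa using this
      · exact fun e => hl (sigma_mk_injective (β := fun i => Fin (b i)) e)
      · intro e
        have := congrArg Sigma.fst e
        exact hpq this
    have hxq : x q = 1 := by
      have := h2 (by simp [Finset.sum_add_distrib])
      rw [Finset.sum_eq_add p q hne (fun y _ hy => h0' y hy.1 hy.2) (by simp) (by simp)] at this
      linarith
    intro y
    by_cases hyp : y = p
    · subst hyp
      simp [hxp, hne]
    by_cases hyq : y = q
    · subst hyq
      simp [hxq, hyp]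
    simp [h0' y hyp hyq, hyp, hyq]

theorem single_two_mem_extremePoints {p : Σ i : Fin k, Fin (b i)} (hp : 2 ≤ a p.1) :
    (fun x => ((Pi.single p 2 : (Σ i : Fin k, Fin (b i)) → ℕ) x : ℝ)) ∈
      Set.extremePoints ℝ (secantPolytope a b) := by
  refine mem_extremePoints_of_tight ?_ ?_
  · rw [← zero_add (Pi.single p 2), add_single_mem_secantLattice_iff]
    refine ⟨fun i => ?_, by simp⟩
    by_cases h : i = p.1
    · subst h
      simpa using hp
    · simp [h]
  · intro x h0 _ h2
    have h0' : ∀ y, y ≠ p → x y = 0 := fun y hyp => h0 y (by simp [hyp])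
    have := h2 (by simp)
    rw [Finset.sum_eq_single p (fun y _ hy => h0' y hy) (by simp)] at this
    intro y
    by_cases hyp : y = p
    · subst hyp
      simp [this]
    · simp [h0' y hyp, hyp]

theorem exists_eq_productVertex (hb : ∀ i, 1 ≤ b i) {c : (Σ i : Fin k, Fin (b i)) → ℕ}
    (hS : c ∈ secantLattice a b)
    (hc : (fun p => (c p : ℝ)) ∈ Set.extremePoints ℝ (secantPolytope a b))
    (h3 : 3 ≤ ∑ p, c p) : ∃ T j, c = productVertex a b T j := by
  classical
  have hj : ∀ i, ∃ j : Fin (b i), ∀ l, c ⟨i, l⟩ ≠ 0 → l = j := by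
    intro i
    by_cases h : ∃ j, c ⟨i, j⟩ ≠ 0
    · obtain ⟨j, hj⟩ := h
      exact ⟨j, fun l hl => sigma_mk_injective (β := fun i => Fin (b i))
        (eq_of_extreme_of_fst_eq (p := ⟨i, l⟩) (q := ⟨i, j⟩) hS hc rfl hl hj)⟩
    · push Not at h
      exact ⟨⟨0, hb i⟩, fun l hl => absurd (h l) hl⟩
  choose j hj using hj
  refine ⟨univ.filter fun i => c ⟨i, j i⟩ ≠ 0, j, ?_⟩
  funext ⟨i, l⟩
  by_cases hl : c ⟨i, l⟩ = 0
  · rw [hl, productVertex, if_neg]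
    rintro ⟨h1, h2⟩
    dsimp only at h1 h2
    subst h2
    simp [hl] at h1
  · have e := hj i l hl
    subst e
    have h := eq_of_extreme_of_three_le hS hc h3 hl
    rw [Finset.sum_eq_single (j i) (fun l _ hne => by_contra fun h' => hne (hj i l h'))
      (by simp)] at h
    simp [productVertex, h]

end SecantPolytope

/-- Complete classification of the vertices of the secant polytope: `v` is an extreme
point of `P` iff it is (i) a vertex `∑_{i ∈ T} (a i) • e_{⟨i, j i⟩}` of the product of
dilated simplices with `∑_{i ∈ T} a i ≥ 2`, or (ii) `e_p + e_q` with distinct block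
indices and `min (a i) (a i') = 1`, or (iii) `2 • e_p` with `2 ≤ a i`. -/
theorem stmt_15 (k : ℕ) (hk : 1 ≤ k) (a b : Fin k → ℕ)
    (ha : ∀ i, 1 ≤ a i) (hb : ∀ i, 1 ≤ b i)
    (S : Set ((Σ i : Fin k, Fin (b i)) → ℕ))
    (hS : S = {c | (∀ i : Fin k, ∑ j, c ⟨i, j⟩ ≤ a i) ∧ 2 ≤ ∑ p, c p})
    (P : Set ((Σ i : Fin k, Fin (b i)) → ℝ))
    (hP : P = convexHull ℝ ((fun (c : (Σ i : Fin k, Fin (b i)) → ℕ)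
      (p : Σ i : Fin k, Fin (b i)) => (c p : ℝ)) '' S))
    (v : (Σ i : Fin k, Fin (b i)) → ℝ) :
    v ∈ Set.extremePoints ℝ P ↔
      ((∃ T : Finset (Fin k), ∃ j : (i : Fin k) → Fin (b i),
          v = ∑ i ∈ T, (a i : ℝ) •
            (Pi.single (⟨i, j i⟩ : Σ i : Fin k, Fin (b i)) (1 : ℝ) :
              (Σ i : Fin k, Fin (b i)) → ℝ) ∧
          2 ≤ ∑ i ∈ T, a i) ∨
       (∃ p q : Σ i : Fin k, Fin (b i), p.1 ≠ q.1 ∧ min (a p.1) (a q.1) = 1 ∧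
          v = (Pi.single p (1 : ℝ) : (Σ i : Fin k, Fin (b i)) → ℝ) +
            (Pi.single q (1 : ℝ) : (Σ i : Fin k, Fin (b i)) → ℝ)) ∨
       (∃ p : Σ i : Fin k, Fin (b i), 2 ≤ a p.1 ∧
          v = (2 : ℝ) •
            (Pi.single p (1 : ℝ) : (Σ i : Fin k, Fin (b i)) → ℝ))) := by
  obtain rfl : S = secantLattice a b := hS
  obtain rfl : P = secantPolytope a b := hP
  constructor
  · intro hv
    obtain ⟨c, hS, rfl⟩ := extremePoints_convexHull_subset hv
    by_cases h3 : 3 ≤ ∑ p, c p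
    · obtain ⟨T, j, rfl⟩ := exists_eq_productVertex hb hS hv h3
      exact Or.inl ⟨T, j, cast_productVertex T j, by rw [← sum_productVertex T j]; exact hS.2⟩
    · obtain ⟨p, q, rfl⟩ := exists_single_add_single_of_sum_eq_two c (by have := hS.2; omega)
      rw [add_single_mem_secantLattice_iff] at hS
      simp only [sum_block_single_s15] at hS
      by_cases hpq : p = q
      · subst hpq
        refine Or.inr (Or.inr ⟨p, by simpa using hS.1 p.1, ?_⟩)
        funext x
        simp only [Pi.add_apply, Pi.smul_apply, Pi.single_apply]
        split_ifs <;> norm_num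
      · have hv' := hv
        rw [← zero_add (Pi.single p 1)] at hv'
        have hmem : ¬ (0 + Pi.single p 2 ∈ secantLattice a b ∧
            0 + Pi.single q 2 ∈ secantLattice a b) := fun h =>
          hpq (eq_of_extreme_add_single_add_single hv' h.1 h.2)
        have hbound : ∀ y : Σ i : Fin k, Fin (b i), 2 ≤ a y.1 →
            0 + Pi.single y 2 ∈ secantLattice a b := by
          intro y hy
          rw [add_single_mem_secantLattice_iff]
          refine ⟨fun i => ?_, by simp⟩
          by_cases h : i = y.1
          · subst h
            simpa using hy
          · simp [h]
        have hfst : p.1 ≠ q.1 := by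
          intro e
          have := hS.1 q.1
          simp only [e, if_true] at this
          exact hmem ⟨hbound p (by rw [e]; omega), hbound q (by omega)⟩
        refine Or.inr (Or.inl ⟨p, q, hfst, ?_, ?_⟩)
        · by_contra hmin
          have := ha p.1
          have := ha q.1
          exact hmem ⟨hbound p (by omega), hbound q (by omega)⟩
        · funext x
          simp only [Pi.add_apply, Pi.single_apply]
          push_cast
          rfl
  · rintro (⟨T, j, rfl, hT⟩ | ⟨p, q, hpq, hmin, rfl⟩ | ⟨p, hp, rfl⟩)
    · rw [← cast_productVertex]
      exact productVertex_mem_extremePoints T j hT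
    · rcases (by omega : a p.1 = 1 ∨ a q.1 = 1) with h | h
      · convert single_add_single_mem_extremePoints_s15 ha hpq h using 1
        funext x
        simp only [Pi.add_apply, Pi.single_apply]
        push_cast
        rfl
      · convert single_add_single_mem_extremePoints_s15 ha hpq.symm h using 1
        funext x
        simp only [Pi.add_apply, Pi.single_apply]
        push_cast
        exact add_comm _ _
    · convert single_two_mem_extremePoints hp using 1
      funext x
      simp only [Pi.smul_apply, Pi.single_apply]
      split_ifs <;> norm_num
end
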